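/- Let R^3 be the profile ≽_1: a,c,{b,d}; ≽_2: {b,d},a,c; ≽_3: a,d,{b,c}; ≽_4: {b,c},a,d, and let R^4 be obtained from R^3 by replacing agent 1's preference with ≽_1: a,{b,c,d}. If f(R^3)(a) > 1/2, then f(R^4)(a) > 1/2. -/

import Mathlib

open Finset
open scoped Classical

section Framework

variable {A : Type*} [Fintype A] {n : ℕ}

/-- `p` is a lottery (probability distribution) on the set of alternatives `A`. -/
def IsLottery (p : A → ℝ) : Prop := (∀ x, 0 ≤ p x) ∧ ∑ x, p x = 1

/-- `r` is a weak preference relation: complete (total) and transitive. -/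
def IsPref (r : A → A → Prop) : Prop := Total r ∧ Transitive r

/-- A preference profile assigns a weak preference relation to each of the `n` agents. -/
def IsProfile (R : Fin n → A → A → Prop) : Prop := ∀ i, IsPref (R i)

/-- The probability that `p` assigns to alternatives weakly preferred (by `r`) to `x`. -/
noncomputable def upperProb (r : A → A → Prop) (p : A → ℝ) (x : A) : ℝ :=
  ∑ y ∈ univ.filter (fun y => r y x), p y

/-- Stochastic dominance: `p ≽^sd q` w.r.t. the preference relation `r`. -/
def SDge (r : A → A → Prop) (p q : A → ℝ) : Prop :=
  ∀ x, upperProb r q x ≤ upperProb r p x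

/-- Strict stochastic dominance: `p ≻^sd q` w.r.t. the preference relation `r`. -/
def SDgt (r : A → A → Prop) (p q : A → ℝ) : Prop :=
  SDge r p q ∧ ¬ SDge r q p

/-- A social decision scheme maps every preference profile to a lottery. -/
def IsSDS (f : (Fin n → A → A → Prop) → (A → ℝ)) : Prop :=
  ∀ R : Fin n → A → A → Prop, IsProfile R → IsLottery (f R)

/-- Anonymity: invariance under permutations of the agents. -/
def Anonymous (f : (Fin n → A → A → Prop) → (A → ℝ)) : Prop :=
  ∀ R : Fin n → A → A → Prop, IsProfile R → ∀ π : Equiv.Perm (Fin n),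
    f (fun i => R (π i)) = f R

/-- Neutrality: `f(R^σ)(σ x) = f(R)(x)`, where `R^σ` relabels alternatives by `σ`
(i.e. `σ x ≽^σ_i σ y ↔ x ≽_i y`). -/
def Neutral (f : (Fin n → A → A → Prop) → (A → ℝ)) : Prop :=
  ∀ R : Fin n → A → A → Prop, IsProfile R → ∀ σ : Equiv.Perm A, ∀ x : A,
    f (fun i u v => R i (σ.symm u) (σ.symm v)) (σ x) = f R x

/-- The lottery `p` is sd-efficient for the profile `R`: no lottery `q` is weakly
sd-preferred to `p` by all agents and strictly sd-preferred by some agent. -/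
def SDEfficientLottery (R : Fin n → A → A → Prop) (p : A → ℝ) : Prop :=
  ¬ ∃ q : A → ℝ, IsLottery q ∧ (∀ i, SDge (R i) q p) ∧ (∃ i, SDgt (R i) q p)

/-- sd-efficiency of a social decision scheme. -/
def SDEfficient (f : (Fin n → A → A → Prop) → (A → ℝ)) : Prop :=
  ∀ R : Fin n → A → A → Prop, IsProfile R → SDEfficientLottery R (f R)

/-- sd-strategyproofness: no agent can misreport and obtain a strictly
sd-preferred lottery. -/
def SDStrategyproof (f : (Fin n → A → A → Prop) → (A → ℝ)) : Prop :=
  ∀ R R' : Fin n → A → A → Prop, IsProfile R → IsProfile R' → ∀ i : Fin n,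
    (∀ j, j ≠ i → R j = R' j) → ¬ SDgt (R i) (f R') (f R)

/-- `x` is the unique most-preferred alternative of the relation `r`. -/
def UniqueTop (r : A → A → Prop) (x : A) : Prop :=
  ∀ y, y ≠ x → r x y ∧ ¬ r y x

/-- `f` extends random dictatorship: whenever every agent has a unique top choice,
each alternative gets probability (number of agents having it as top)/n. -/
def ExtendsRD (f : (Fin n → A → A → Prop) → (A → ℝ)) : Prop :=
  ∀ R : Fin n → A → A → Prop, IsProfile R →
    ∀ t : Fin n → A, (∀ i, UniqueTop (R i) (t i)) →
      ∀ x : A, f R x = ((univ.filter (fun i => t i = x)).card : ℝ) / (n : ℝ)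

/-- `x` is Pareto-dominated in the profile `R`. -/
def Pareto_Dominated (R : Fin n → A → A → Prop) (x : A) : Prop :=
  ∃ y : A, (∀ i, R i y x) ∧ ∃ i, R i y x ∧ ¬ R i x y

end Framework

/-! Concrete setting: alternatives `A = {a,b,c,d}` encoded as `Fin 4`. -/

/-- The alternative `a`. -/ def a : Fin 4 := 0
/-- The alternative `b`. -/ def b : Fin 4 := 1
/-- The alternative `c`. -/ def c : Fin 4 := 2
/-- The alternative `d`. -/ def d : Fin 4 := 3

/-- The weak preference relation induced by a rank function over `(a,b,c,d)`
(lower rank = more preferred; equal ranks = indifference). -/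
def pr (rk : Fin 4 → ℕ) : Fin 4 → Fin 4 → Prop := fun x y => rk x ≤ rk y


/-- The profile `R3`: ≽₁: a,c,{b,d}; ≽₂: {b,d},a,c; ≽₃: a,d,{b,c}; ≽₄: {b,c},a,d. -/
def R3 : Fin 4 → Fin 4 → Fin 4 → Prop :=
  ![pr ![0,2,1,2], pr ![1,0,2,0], pr ![0,2,2,1], pr ![1,0,0,2]]

/-- The profile `R4`: ≽₁: a,{b,c,d}; ≽₂: {b,d},a,c; ≽₃: a,d,{b,c}; ≽₄: {b,c},a,d. -/
def R4 : Fin 4 → Fin 4 → Fin 4 → Prop :=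
  ![pr ![0,1,1,1], pr ![1,0,2,0], pr ![0,2,2,1], pr ![1,0,0,2]]

theorem isPref_pr (rk : Fin 4 → ℕ) : IsPref (pr rk) :=
  ⟨fun x y => le_total (rk x) (rk y), fun _ _ _ h h' => le_trans h h'⟩

theorem isProfile_R3 : IsProfile R3 := by
  intro i; fin_cases i <;> exact isPref_pr _

theorem isProfile_R4 : IsProfile R4 := by
  intro i; fin_cases i <;> exact isPref_pr _

theorem upperProb_pr_top (p : Fin 4 → ℝ) : upperProb (pr ![0,1,1,1]) p a = p a := by
  simp [upperProb, pr, a, Finset.sum_filter, Fin.sum_univ_four]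

theorem upperProb_pr_of_ne_top (p : Fin 4 → ℝ) (hp : IsLottery p) {x : Fin 4} (hx : x ≠ a) :
    upperProb (pr ![0,1,1,1]) p x = 1 := by
  rw [← hp.2, upperProb, Finset.filter_true_of_mem]
  intro y _
  fin_cases x <;> fin_cases y <;> simp_all [pr, a]

/-- For an agent who is indifferent between all alternatives other than `a`,
strict stochastic dominance amounts to a larger probability of `a`. -/
theorem sdgt_pr_top {p q : Fin 4 → ℝ} (hp : IsLottery p) (hq : IsLottery q) (h : q a < p a) :
    SDgt (pr ![0,1,1,1]) p q := by
  refine ⟨fun x => ?_, fun hge => ?_⟩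
  · by_cases hx : x = a
    · rw [hx, upperProb_pr_top, upperProb_pr_top]
      exact h.le
    · rw [upperProb_pr_of_ne_top p hp hx, upperProb_pr_of_ne_top q hq hx]
  · have := hge a
    rw [upperProb_pr_top, upperProb_pr_top] at this
    exact h.not_ge this

theorem stmt7 (f : (Fin 4 → Fin 4 → Fin 4 → Prop) → (Fin 4 → ℝ))
    (hf : IsSDS f) (han : Anonymous f) (hneu : Neutral f)
    (heff : SDEfficient f) (hsp : SDStrategyproof f) :
    f R3 a > 1/2 → f R4 a > 1/2 := by
  intro h
  by_contra hlt
  refine hsp R4 R3 isProfile_R4 isProfile_R3 0 (fun j hj => ?_)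
    (sdgt_pr_top (hf R3 isProfile_R3) (hf R4 isProfile_R4) (by linarith))
  fin_cases j
  · exact absurd rfl hj
  all_goals rfl
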